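/- Let n be a natural number and let κ, μ : Fin n → ℝ satisfy κ_α · κ_β = μ_α · μ_β for all indices α ≠ β. If κ has at least three nonzero entries, then σ_1(κ)² = σ_1(μ)², i.e. (κ_1 + ⋯ + κ_n)² = (μ_1 + ⋯ + μ_n)². -/

import Mathlib

/-- The `m`-th elementary symmetric function of the family `κ : Fin n → ℝ`:
the sum over all `m`-element subsets `S` of `Fin n` of `∏ i ∈ S, κ i`. -/
noncomputable def esymmFun (n m : ℕ) (κ : Fin n → ℝ) : ℝ :=
  ∑ S ∈ Finset.powersetCard m (Finset.univ : Finset (Fin n)), ∏ i ∈ S, κ i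

theorem stmt_8 (n : ℕ) (κ μ : Fin n → ℝ)
    (h : ∀ α β : Fin n, α ≠ β → κ α * κ β = μ α * μ β)
    (hrank : ∃ i j k : Fin n, i ≠ j ∧ i ≠ k ∧ j ≠ k ∧ κ i ≠ 0 ∧ κ j ≠ 0 ∧ κ k ≠ 0) :
    (esymmFun n 1 κ) ^ 2 = (esymmFun n 1 μ) ^ 2 := by
  obtain ⟨i, j, k, hij, hik, hjk, hi, hj, hk⟩ := hrank
  have e : ∀ ν : Fin n → ℝ, esymmFun n 1 ν = ∑ a, ν a := by
    intro ν
    simp [esymmFun, Finset.powersetCard_one]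
  have hsq : κ i ^ 2 = μ i ^ 2 := by
    have h1 := h i j hij
    have h2 := h i k hik
    have h3 := h j k hjk
    have h4 : κ j * κ k ≠ 0 := mul_ne_zero hj hk
    apply mul_right_cancel₀ h4
    calc κ i ^ 2 * (κ j * κ k) = (κ i * κ j) * (κ i * κ k) := by ring
      _ = μ i ^ 2 * (μ j * μ k) := by rw [h1, h2]; ring
      _ = μ i ^ 2 * (κ j * κ k) := by rw [h3]
  have key : ∀ a, κ a * μ i = κ i * μ a := by
    intro a
    by_cases ha : a = i
    · subst ha; rfl
    · have h1 := h a i ha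
      apply mul_left_cancel₀ hi
      linear_combination μ i * h1 - μ a * hsq
  have hs : (∑ a, κ a) * μ i = κ i * ∑ a, μ a := by
    rw [Finset.sum_mul, Finset.mul_sum]
    exact Finset.sum_congr rfl fun a _ => key a
  rw [e, e]
  apply mul_left_cancel₀ (pow_ne_zero 2 hi)
  have h5 : ((∑ a, κ a) * μ i) ^ 2 = (κ i * ∑ a, μ a) ^ 2 := by rw [hs]
  linear_combination h5 + (∑ a, κ a) ^ 2 * hsq
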